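/- Let n ≥ 1 and let (a_{ij})_{1 ≤ i < j ≤ n} be real numbers that are linearly independent over ℚ. Then the number of regions of the arrangement in V_{n-1} consisting of the hyperplanes x_i − x_j = a_{ij} for 1 ≤ i < j ≤ n equals the number of forests on n labelled vertices, i.e., the number of simple graphs on the vertex set {1,...,n} containing no cycle. -/

import Mathlib

/-- The number of regions of the complement of an arrangement. -/
noncomputable def numRegions {V : Type*} [TopologicalSpace V] (s : Set V) : ℕ :=
  Nat.card (ConnectedComponents s)

section GenericArrangement

variable {V ι : Type*} [AddCommGroup V] [Module ℝ V]

/-- The points of `W` lying on all the hyperplanes `f t = a t` with `t ∈ T`. -/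
def arrangementFlat (W : Submodule ℝ V) (f : ι → V →ₗ[ℝ] ℝ) (a : ι → ℝ) (T : Finset ι) : Set V :=
  {x | x ∈ W ∧ ∀ t ∈ T, f t x = a t}

/-- The points of the flat of `T` lying strictly above the hyperplanes in `P` and strictly below
those in `E` outside `P`. -/
def arrangementCell (W : Submodule ℝ V) (f : ι → V →ₗ[ℝ] ℝ) (a : ι → ℝ) (T E P : Finset ι) :
    Set V :=
  {x | x ∈ arrangementFlat W f a T ∧
    ∀ e ∈ E, (e ∈ P → a e < f e x) ∧ (e ∉ P → f e x < a e)}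

variable {W : Submodule ℝ V} {f : ι → V →ₗ[ℝ] ℝ} {a : ι → ℝ} {T E P : Finset ι}

theorem convex_arrangementCell : Convex ℝ (arrangementCell W f a T E P) := by
  rintro x ⟨⟨hxW, hxT⟩, hxE⟩ y ⟨⟨hyW, hyT⟩, hyE⟩ b c hb hc hbc
  refine ⟨⟨W.add_mem (W.smul_mem _ hxW) (W.smul_mem _ hyW), fun t ht => ?_⟩,
    fun e he => ⟨fun hP => ?_, fun hP => ?_⟩⟩
  · simp only [map_add, map_smul, hxT t ht, hyT t ht, smul_eq_mul, ← add_mul, hbc, one_mul]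
  · have := convex_Ioi (𝕜 := ℝ) (a e) ((hxE e he).1 hP) ((hyE e he).1 hP) hb hc hbc
    simpa using this
  · have := convex_Iio (𝕜 := ℝ) (a e) ((hxE e he).2 hP) ((hyE e he).2 hP) hb hc hbc
    simpa using this

open Topology in
theorem eventually_add_smul_mem_arrangementCell {x v : V} (hx : x ∈ arrangementCell W f a T E P)
    (hvW : v ∈ W) (hvT : ∀ t ∈ T, f t v = 0) :
    ∀ᶠ s in 𝓝 (0 : ℝ), x + s • v ∈ arrangementCell W f a T E P := by
  have hcont (e : ι) : Filter.Tendsto (fun s : ℝ => f e (x + s • v)) (𝓝 0) (𝓝 (f e x)) := by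
    have : Continuous fun s : ℝ => f e x + s * f e v := by fun_prop
    simpa using this.tendsto 0
  have hE : ∀ᶠ s in 𝓝 (0 : ℝ), ∀ e ∈ E, (e ∈ P → a e < f e (x + s • v)) ∧
      (e ∉ P → f e (x + s • v) < a e) := by
    refine (Filter.eventually_all_finset E).2 fun e he => ?_
    by_cases hP : e ∈ P
    · filter_upwards [(hcont e).eventually_const_lt ((hx.2 e he).1 hP)] with s hs
      exact ⟨fun _ => hs, fun h => absurd hP h⟩
    · filter_upwards [(hcont e).eventually_lt_const ((hx.2 e he).2 hP)] with s hs
      exact ⟨fun h => absurd h hP, fun _ => hs⟩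
  filter_upwards [hE] with s hs
  exact ⟨⟨W.add_mem hx.1.1 (W.smul_mem _ hvW), fun t ht => by simp [hvT t ht, hx.1.2 t ht]⟩, hs⟩

theorem exists_mem_arrangementCell_lt_gt {e : ι} {x v : V}
    (hx : x ∈ arrangementCell W f a T E P) (hxe : f e x = a e)
    (hvW : v ∈ W) (hvT : ∀ t ∈ T, f t v = 0) (hve : f e v ≠ 0) :
    (∃ y ∈ arrangementCell W f a T E P, f e y < a e) ∧
      ∃ y ∈ arrangementCell W f a T E P, a e < f e y := by
  have h := eventually_add_smul_mem_arrangementCell (v := (f e v)⁻¹ • v) hx (W.smul_mem _ hvW)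
    (fun t ht => by simp [hvT t ht])
  obtain ⟨δ, hδ, h⟩ := Metric.eventually_nhds_iff.1 h
  refine ⟨⟨_, h (y := -(δ / 2)) ?_, ?_⟩, ⟨_, h (y := δ / 2) ?_, ?_⟩⟩
  · rw [dist_zero_right, norm_neg, Real.norm_of_nonneg (by positivity)]; linarith
  · simp [hxe, hve, hδ]
  · rw [dist_zero_right, Real.norm_of_nonneg (by positivity)]; linarith
  · simp [hxe, hve, hδ]

theorem exists_mem_arrangementCell_eq {e : ι} {x y : V}
    (hx : x ∈ arrangementCell W f a T E P) (hy : y ∈ arrangementCell W f a T E P)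
    (hxe : f e x < a e) (hye : a e < f e y) :
    ∃ z ∈ arrangementCell W f a T E P, f e z = a e := by
  have hd : 0 < f e y - f e x := by linarith
  have hb : 0 ≤ (f e y - a e) / (f e y - f e x) := div_nonneg (by linarith) hd.le
  have hc : 0 ≤ (a e - f e x) / (f e y - f e x) := div_nonneg (by linarith) hd.le
  refine ⟨_, convex_arrangementCell hx hy hb hc ?_, ?_⟩
  · field_simp; ring
  · simp only [map_add, map_smul, smul_eq_mul]; field_simp; ring

variable [DecidableEq ι]

theorem mem_arrangementCell_insert {e : ι} {x : V} :
    x ∈ arrangementCell W f a (insert e T) E P ↔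
      x ∈ arrangementCell W f a T E P ∧ f e x = a e := by
  simp only [arrangementCell, arrangementFlat, Set.mem_ofPred_eq, Finset.forall_mem_insert]
  tauto

theorem mem_arrangementCell_insert_of_notMem {e : ι} {x : V} (heP : e ∉ P) :
    x ∈ arrangementCell W f a T (insert e E) P ↔
      x ∈ arrangementCell W f a T E P ∧ f e x < a e := by
  simp only [arrangementCell, Set.mem_ofPred_eq, Finset.forall_mem_insert, heP]
  tauto

theorem mem_arrangementCell_insert_insert {e : ι} {x : V} (heE : e ∉ E) :
    x ∈ arrangementCell W f a T (insert e E) (insert e P) ↔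
      x ∈ arrangementCell W f a T E P ∧ a e < f e x := by
  have h : ∀ i ∈ E, (i ∈ insert e P ↔ i ∈ P) := fun i hi => by
    have : i ≠ e := fun h => heE (h ▸ hi)
    simp [this]
  simp only [arrangementCell, Set.mem_ofPred_eq, Finset.forall_mem_insert, Finset.mem_insert_self]
  have : (∀ i ∈ E, (i ∈ insert e P → a i < f i x) ∧ (i ∉ insert e P → f i x < a i)) ↔
      ∀ i ∈ E, (i ∈ P → a i < f i x) ∧ (i ∉ P → f i x < a i) :=
    forall₂_congr fun i hi => by rw [h i hi]
  rw [this]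
  tauto

open Classical in
theorem arrangementCell_nonempty_deletion_restriction {e : ι} (heE : e ∉ E) (heP : e ∉ P)
    (hgen : (arrangementFlat W f a (insert e T)).Nonempty →
      ∃ v ∈ W, (∀ t ∈ T, f t v = 0) ∧ f e v ≠ 0) :
    ((if (arrangementCell W f a T (insert e E) P).Nonempty then 1 else 0) +
      if (arrangementCell W f a T (insert e E) (insert e P)).Nonempty then 1 else 0) =
    (if (arrangementCell W f a T E P).Nonempty then 1 else 0) +
      if (arrangementCell W f a (insert e T) E P).Nonempty then 1 else 0 := by
  simp only [Set.nonempty_def, mem_arrangementCell_insert, mem_arrangementCell_insert_of_notMem heP,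
    mem_arrangementCell_insert_insert heE]
  have hC : (∃ x, x ∈ arrangementCell W f a T E P ∧ f e x = a e) ↔
      (∃ x, x ∈ arrangementCell W f a T E P ∧ f e x < a e) ∧
        ∃ x, x ∈ arrangementCell W f a T E P ∧ a e < f e x := by
    constructor
    · rintro ⟨x, hx, hxe⟩
      obtain ⟨v, hvW, hvT, hve⟩ := hgen ⟨x, (mem_arrangementCell_insert.2 ⟨hx, hxe⟩).1⟩
      exact exists_mem_arrangementCell_lt_gt hx hxe hvW hvT hve
    · rintro ⟨⟨x, hx, hxe⟩, y, hy, hye⟩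
      exact exists_mem_arrangementCell_eq hx hy hxe hye
  have hU : (∃ x, x ∈ arrangementCell W f a T E P) ↔
      (∃ x, x ∈ arrangementCell W f a T E P ∧ f e x < a e) ∨
        ∃ x, x ∈ arrangementCell W f a T E P ∧ a e < f e x := by
    constructor
    · rintro ⟨x, hx⟩
      rcases lt_trichotomy (f e x) (a e) with h | h | h
      · exact Or.inl ⟨x, hx, h⟩
      · exact Or.inl (hC.1 ⟨x, hx, h⟩).1
      · exact Or.inr ⟨x, hx, h⟩
    · rintro (⟨x, hx, -⟩ | ⟨x, hx, -⟩) <;> exact ⟨x, hx⟩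
  simp only [hC, hU]
  by_cases hA : ∃ x, x ∈ arrangementCell W f a T E P ∧ f e x < a e <;>
    by_cases hB : ∃ x, x ∈ arrangementCell W f a T E P ∧ a e < f e x <;>
    simp only [hA, hB, and_true, and_false, or_true, or_false, if_true, if_false]

open Classical in
/-- In a generic arrangement, the nonempty cells are equinumerous with the subfamilies of
hyperplanes having a common point. -/
theorem card_arrangementCell_nonempty_eq
    (hgen : ∀ (T : Finset ι) (e : ι), e ∉ T → (arrangementFlat W f a (insert e T)).Nonempty →
      ∃ v ∈ W, (∀ t ∈ T, f t v = 0) ∧ f e v ≠ 0)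
    (E : Finset ι) : ∀ T : Finset ι, Disjoint E T →
      (E.powerset.filter fun P => (arrangementCell W f a T E P).Nonempty).card =
        (E.powerset.filter fun S => (arrangementFlat W f a (T ∪ S)).Nonempty).card := by
  simp only [Finset.card_filter]
  induction E using Finset.induction_on with
  | empty =>
    intro T _
    simp only [Finset.powerset_empty, Finset.sum_singleton]
    simp [arrangementCell]
  | insert e E he ih =>
    intro T hT
    rw [Finset.disjoint_insert_left] at hT
    rw [Finset.sum_powerset_insert he, Finset.sum_powerset_insert he, ← Finset.sum_add_distrib,
      Finset.sum_congr rfl fun P hP => arrangementCell_nonempty_deletion_restriction he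
        (fun h => he (Finset.mem_powerset.1 hP h)) (hgen T e hT.1),
      Finset.sum_add_distrib, ih T hT.2,
      ih (insert e T) (Finset.disjoint_insert_right.2 ⟨he, hT.2⟩)]
    simp only [Finset.union_insert, Finset.insert_union]

end GenericArrangement

section Regions

variable {V ι : Type*} [AddCommGroup V] [Module ℝ V] [TopologicalSpace V]
  [IsTopologicalAddGroup V] [ContinuousSMul ℝ V] [Fintype ι]

open Classical in
theorem numRegions_eq_card_arrangementCell_nonempty (W : Submodule ℝ V) (f : ι → V →ₗ[ℝ] ℝ)
    (hf : ∀ i, Continuous (f i)) (a : ι → ℝ) :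
    numRegions {x : V | x ∈ W ∧ ∀ i, f i x ≠ a i} =
      (Finset.univ.filter fun P =>
        (arrangementCell W f a ∅ Finset.univ P).Nonempty).card := by
  set s : Set V := {x : V | x ∈ W ∧ ∀ i, f i x ≠ a i}
  let _ : TopologicalSpace (Finset ι) := ⊥
  have : DiscreteTopology (Finset ι) := ⟨rfl⟩
  let σ : s → Finset ι := fun x => Finset.univ.filter fun i => a i < f i x
  have hcell (x : V) (P : Finset ι) : x ∈ arrangementCell W f a ∅ Finset.univ P ↔
      ∃ h : x ∈ s, σ ⟨x, h⟩ = P := by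
    constructor
    · rintro ⟨⟨hW, -⟩, h⟩
      refine ⟨⟨hW, fun i => ?_⟩, ?_⟩
      · by_cases hi : i ∈ P
        · exact ((h i (Finset.mem_univ i)).1 hi).ne'
        · exact ((h i (Finset.mem_univ i)).2 hi).ne
      · ext i
        simp only [σ, Finset.mem_filter, Finset.mem_univ, true_and]
        refine ⟨fun hi => ?_, (h i (Finset.mem_univ i)).1⟩
        by_contra hP
        exact hi.not_gt ((h i (Finset.mem_univ i)).2 hP)
    · rintro ⟨h, rfl⟩
      refine ⟨⟨h.1, by simp⟩, fun i _ => ⟨by simp [σ], fun hi => ?_⟩⟩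
      simp only [σ, Finset.mem_filter, Finset.mem_univ, true_and, not_lt] at hi
      exact lt_of_le_of_ne hi (h.2 i)
  have hσ : Continuous σ := by
    refine (IsLocallyConstant.iff_eventually_eq σ).2 (fun x => ?_) |>.continuous
    have hc (i : ι) : Filter.Tendsto (fun y : s => f i y) (nhds x) (nhds (f i (x : V))) :=
      ((hf i).comp continuous_subtype_val).tendsto x
    have : ∀ᶠ y : s in nhds x, ∀ i, (a i < f i (y : V) ↔ a i < f i (x : V)) := by
      refine Filter.eventually_all.2 fun i => ?_
      rcases lt_or_gt_of_ne (x.2.2 i) with h | h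
      · filter_upwards [(hc i).eventually_lt_const h] with y hy
        exact iff_of_false hy.not_gt h.not_gt
      · filter_upwards [(hc i).eventually_const_lt h] with y hy
        exact iff_of_true hy h
    filter_upwards [this] with y hy
    ext i
    simp [σ, hy i]
  have hinj : Function.Injective hσ.connectedComponentsLift := by
    intro x y
    induction x using Quotient.inductionOn' with | h x => ?_
    induction y using Quotient.inductionOn' with | h y => ?_
    intro hxy
    replace hxy : σ x = σ y := hxy
    refine ConnectedComponents.coe_eq_coe'.2 ?_
    have hpre : IsPreconnected (σ ⁻¹' {σ y}) := by
      rw [← Topology.IsInducing.subtypeVal.isPreconnected_image]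
      convert (convex_arrangementCell (W := W) (f := f) (a := a) (T := ∅) (E := Finset.univ)
        (P := σ y)).isPreconnected using 1
      ext z
      rw [hcell]
      simp
    exact hpre.subset_connectedComponent (x := y) rfl hxy
  rw [numRegions, Nat.card_congr (Equiv.ofInjective _ hinj), ← Set.ncard_coe_finset,
    Nat.card_coe_set_eq]
  congr 1
  ext P
  simp only [Finset.coe_filter, Finset.mem_univ, true_and, Set.mem_ofPred_eq, Set.Nonempty, hcell,
    Set.mem_range]
  constructor
  · rintro ⟨x, rfl⟩
    induction x using Quotient.inductionOn' with | h x => ?_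
    exact ⟨x, x.2, rfl⟩
  · rintro ⟨x, h, rfl⟩
    exact ⟨((⟨x, h⟩ : s) : ConnectedComponents s), rfl⟩

end Regions

section PairGraph

variable {n : ℕ}

/-- The simple graph on `Fin n` with a given set of edges, written as increasing pairs. -/
def pairGraph (S : Finset {p : Fin n × Fin n // p.1 < p.2}) : SimpleGraph (Fin n) where
  Adj i j := ∃ p ∈ S, (p.1.1 = i ∧ p.1.2 = j) ∨ (p.1.1 = j ∧ p.1.2 = i)
  symm := ⟨fun _ _ ⟨p, hp, h⟩ => ⟨p, hp, h.symm⟩⟩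
  loopless := ⟨by
    rintro i ⟨p, -, ⟨h, h'⟩ | ⟨h, h'⟩⟩ <;> exact p.2.ne (h.trans h'.symm)⟩

theorem pairGraph_adj_of_mem {S : Finset {p : Fin n × Fin n // p.1 < p.2}}
    {p : {p : Fin n × Fin n // p.1 < p.2}} (hp : p ∈ S) : (pairGraph S).Adj p.1.1 p.1.2 :=
  ⟨p, hp, Or.inl ⟨rfl, rfl⟩⟩

theorem pairGraph_adj_iff_mem {S : Finset {p : Fin n × Fin n // p.1 < p.2}}
    (p : {p : Fin n × Fin n // p.1 < p.2}) : (pairGraph S).Adj p.1.1 p.1.2 ↔ p ∈ S := by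
  refine ⟨?_, pairGraph_adj_of_mem⟩
  rintro ⟨q, hq, ⟨h, h'⟩ | ⟨h, h'⟩⟩
  · rwa [← Subtype.ext (Prod.ext h h')]
  · exact absurd p.2 (by rw [← h, ← h']; exact q.2.not_gt)

theorem pairGraph_injective :
    Function.Injective (pairGraph : Finset {p : Fin n × Fin n // p.1 < p.2} → _) := by
  intro S T h
  ext p
  rw [← pairGraph_adj_iff_mem, h, pairGraph_adj_iff_mem]

theorem pairGraph_surjective :
    Function.Surjective (pairGraph : Finset {p : Fin n × Fin n // p.1 < p.2} → _) := by
  classical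
  intro G
  refine ⟨Finset.univ.filter fun p => G.Adj p.1.1 p.1.2, ?_⟩
  ext i j
  constructor
  · rintro ⟨p, hp, ⟨rfl, rfl⟩ | ⟨rfl, rfl⟩⟩
    · exact (Finset.mem_filter.1 hp).2
    · exact (Finset.mem_filter.1 hp).2.symm
  · intro h
    rcases lt_or_gt_of_ne h.ne with hij | hij
    · exact ⟨⟨(i, j), hij⟩, by simpa using h, Or.inl ⟨rfl, rfl⟩⟩
    · exact ⟨⟨(j, i), hij⟩, by simpa using h.symm, Or.inr ⟨rfl, rfl⟩⟩

theorem pairGraph_mono : Monotone (pairGraph (n := n)) :=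
  fun _ _ hST _ _ ⟨p, hp, h⟩ => ⟨p, hST hp, h⟩

/-- Removing an edge of an acyclic graph separates its endpoints. -/
theorem not_reachable_of_isAcyclic_pairGraph_insert
    {T : Finset {p : Fin n × Fin n // p.1 < p.2}} {e : {p : Fin n × Fin n // p.1 < p.2}}
    (he : e ∉ T) (h : (pairGraph (insert e T)).IsAcyclic) :
    ¬ (pairGraph T).Reachable e.1.1 e.1.2 := by
  have hb := SimpleGraph.isAcyclic_iff_forall_adj_isBridge.1 h
    (pairGraph_adj_of_mem (Finset.mem_insert_self e T))
  rw [SimpleGraph.isBridge_iff] at hb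
  refine fun hr => hb (hr.mono fun i j hij => ?_)
  rw [SimpleGraph.deleteEdges_adj]
  refine ⟨pairGraph_mono (Finset.subset_insert e T) hij, fun hmem => he ?_⟩
  rw [← pairGraph_adj_iff_mem, ← SimpleGraph.mem_edgeSet, ← Set.mem_singleton_iff.1 hmem]
  exact hij

/-- The linear form `x ↦ x i - x j` attached to a pair. -/
def pairForm (p : {p : Fin n × Fin n // p.1 < p.2}) : (Fin n → ℝ) →ₗ[ℝ] ℝ :=
  LinearMap.proj (R := ℝ) (φ := fun _ : Fin n => ℝ) p.1.1 - LinearMap.proj p.1.2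

@[simp]
theorem pairForm_apply (p : {p : Fin n × Fin n // p.1 < p.2}) (x : Fin n → ℝ) :
    pairForm p x = x p.1.1 - x p.1.2 := rfl

/-- The hyperplane of vectors with zero coordinate sum. -/
def sumZero (n : ℕ) : Submodule ℝ (Fin n → ℝ) :=
  LinearMap.ker (∑ i, LinearMap.proj i : (Fin n → ℝ) →ₗ[ℝ] ℝ)

theorem mem_sumZero {x : Fin n → ℝ} : x ∈ sumZero n ↔ ∑ i, x i = 0 := by
  simp [sumZero]

theorem exists_sumZero_pairForm_eq (hn : 1 ≤ n) (y : Fin n → ℝ) :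
    ∃ x ∈ sumZero n, ∀ p, pairForm p x = pairForm p y := by
  refine ⟨fun i => y i - (∑ j, y j) / n, mem_sumZero.2 ?_, fun p => by simp⟩
  have : (n : ℝ) ≠ 0 := by positivity
  simp only [Finset.sum_sub_distrib, Finset.sum_const, Finset.card_univ, Fintype.card_fin,
    nsmul_eq_mul]
  field_simp
  ring

/-- The indicator of a connected component separates the endpoints of a bridge. -/
theorem exists_sumZero_pairForm_eq_one (hn : 1 ≤ n)
    {T : Finset {p : Fin n × Fin n // p.1 < p.2}} {e : {p : Fin n × Fin n // p.1 < p.2}}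
    (he : e ∉ T) (h : (pairGraph (insert e T)).IsAcyclic) :
    ∃ v ∈ sumZero n, (∀ t ∈ T, pairForm t v = 0) ∧ pairForm e v = 1 := by
  classical
  have hr := not_reachable_of_isAcyclic_pairGraph_insert he h
  obtain ⟨v, hv, hvp⟩ := exists_sumZero_pairForm_eq hn
    fun i => if (pairGraph T).Reachable e.1.1 i then (1 : ℝ) else 0
  refine ⟨v, hv, fun t ht => ?_, ?_⟩
  · have hadj := (pairGraph_adj_of_mem ht).reachable
    have : (pairGraph T).Reachable e.1.1 t.1.1 ↔ (pairGraph T).Reachable e.1.1 t.1.2 :=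
      ⟨fun h => h.trans hadj, fun h => h.trans hadj.symm⟩
    simp [hvp, this]
  · simp [hvp, hr]

theorem SimpleGraph.Reachable.sub_mem {α : Type*} {G : SimpleGraph α} (M : Submodule ℚ ℝ)
    (x : α → ℝ) (hG : ∀ i j, G.Adj i j → x i - x j ∈ M) {i j : α} (h : G.Reachable i j) :
    x i - x j ∈ M := by
  obtain ⟨w⟩ := h
  induction w with
  | nil => simp
  | cons hadj _ ih => simpa using M.add_mem (hG _ _ hadj) ih

theorem isAcyclic_pairGraph_of_arrangementFlat_nonempty
    {a : {p : Fin n × Fin n // p.1 < p.2} → ℝ} (ha : LinearIndependent ℚ a)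
    {S : Finset {p : Fin n × Fin n // p.1 < p.2}}
    (h : (arrangementFlat (sumZero n) pairForm a S).Nonempty) : (pairGraph S).IsAcyclic := by
  obtain ⟨x, -, hx⟩ := h
  have key (p : {p : Fin n × Fin n // p.1 < p.2}) (hp : p ∈ S) :
      ¬ ((pairGraph S).deleteEdges {s(p.1.1, p.1.2)}).Reachable p.1.1 p.1.2 := by
    intro hr
    have hmem := hr.sub_mem (Submodule.span ℚ (a '' {p}ᶜ)) x fun i j hij => ?_
    · rw [← pairForm_apply, hx p hp] at hmem
      exact ha.notMem_span_image (by simp) hmem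
    · rw [SimpleGraph.deleteEdges_adj] at hij
      obtain ⟨⟨q, hq, hqij⟩, hne⟩ := hij
      have hqp : q ≠ p := by
        rintro rfl
        rcases hqij with ⟨rfl, rfl⟩ | ⟨rfl, rfl⟩ 
        · exact hne rfl
        · exact hne Sym2.eq_swap
      have hqmem : x q.1.1 - x q.1.2 ∈ Submodule.span ℚ (a '' {p}ᶜ) := by
        rw [← pairForm_apply, hx q hq]
        exact Submodule.subset_span ⟨q, hqp, rfl⟩
      rcases hqij with ⟨rfl, rfl⟩ | ⟨rfl, rfl⟩
      · exact hqmem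
      · simpa using Submodule.neg_mem _ hqmem
  rw [SimpleGraph.isAcyclic_iff_forall_adj_isBridge]
  rintro i j ⟨p, hp, ⟨rfl, rfl⟩ | ⟨rfl, rfl⟩⟩
  · exact key p hp
  · rw [Sym2.eq_swap]
    exact key p hp

theorem arrangementFlat_nonempty_of_isAcyclic_pairGraph (hn : 1 ≤ n)
    (a : {p : Fin n × Fin n // p.1 < p.2} → ℝ) (S : Finset {p : Fin n × Fin n // p.1 < p.2})
    (h : (pairGraph S).IsAcyclic) : (arrangementFlat (sumZero n) pairForm a S).Nonempty := by
  induction S using Finset.induction_on with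
  | empty => exact ⟨0, Submodule.zero_mem _, by simp⟩
  | insert e T he ih =>
    obtain ⟨x, hxW, hx⟩ := ih (h.anti (pairGraph_mono (Finset.subset_insert e T)))
    obtain ⟨v, hvW, hvT, hve⟩ := exists_sumZero_pairForm_eq_one hn he h
    refine ⟨x + (a e - pairForm e x) • v,
      Submodule.add_mem _ hxW (Submodule.smul_mem _ _ hvW), fun t ht => ?_⟩
    rw [map_add, map_smul]
    rcases Finset.mem_insert.1 ht with rfl | ht
    · rw [hve]; simp
    · rw [hvT t ht, hx t ht]; simp

end PairGraph

/-- The number of regions of the generic deformation `x_i - x_j = a_{ij}` (with the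
`a_{ij}` linearly independent over `ℚ`) of the braid arrangement in
`V_{n-1} = {x : ∑ x_i = 0}` equals the number of forests on `n` labelled vertices. -/
theorem stmt3 (n : ℕ) (hn : 1 ≤ n) (a : Fin n → Fin n → ℝ)
    (ha : LinearIndependent ℚ
      (fun p : {p : Fin n × Fin n // p.1 < p.2} => a p.1.1 p.1.2)) :
    numRegions {x : Fin n → ℝ |
        (∑ i, x i) = 0 ∧ ∀ i j : Fin n, i < j → x i - x j ≠ a i j} =
      Nat.card {G : SimpleGraph (Fin n) // G.IsAcyclic} := by
  classical
  have hset : {x : Fin n → ℝ | (∑ i, x i) = 0 ∧ ∀ i j : Fin n, i < j → x i - x j ≠ a i j} =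
      {x | x ∈ sumZero n ∧ ∀ p : {p : Fin n × Fin n // p.1 < p.2},
        pairForm p x ≠ a p.1.1 p.1.2} := by
    ext x
    simp only [Set.mem_ofPred_eq, mem_sumZero, pairForm_apply, Subtype.forall, Prod.forall]
  have hflat (S : Finset {p : Fin n × Fin n // p.1 < p.2}) :
      (arrangementFlat (sumZero n) pairForm (fun p => a p.1.1 p.1.2) S).Nonempty ↔
        (pairGraph S).IsAcyclic :=
    ⟨isAcyclic_pairGraph_of_arrangementFlat_nonempty ha,
      arrangementFlat_nonempty_of_isAcyclic_pairGraph hn _ S⟩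
  have hgen (T : Finset {p : Fin n × Fin n // p.1 < p.2})
      (e : {p : Fin n × Fin n // p.1 < p.2}) (he : e ∉ T)
      (h : (arrangementFlat (sumZero n) pairForm (fun p => a p.1.1 p.1.2) (insert e T)).Nonempty) :
      ∃ v ∈ sumZero n, (∀ t ∈ T, pairForm t v = 0) ∧ pairForm e v ≠ 0 := by
    obtain ⟨v, hvW, hvT, hve⟩ := exists_sumZero_pairForm_eq_one hn he ((hflat _).1 h)
    exact ⟨v, hvW, hvT, by simp [hve]⟩
  have hcard := card_arrangementCell_nonempty_eq hgen Finset.univ ∅ (by simp)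
  simp only [Finset.powerset_univ, Finset.empty_union, hflat] at hcard
  rw [hset, numRegions_eq_card_arrangementCell_nonempty (sumZero n) pairForm
    (fun p => LinearMap.continuous_of_finiteDimensional _) fun p => a p.1.1 p.1.2]
  refine (Eq.trans (by congr) hcard).trans ?_
  rw [← Fintype.card_subtype, ← Nat.card_eq_fintype_card]
  exact Nat.card_congr ((Equiv.ofBijective pairGraph
    ⟨pairGraph_injective, pairGraph_surjective⟩).subtypeEquiv fun S => Iff.rfl)
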